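/- Suppose the m1 × (n·m2) concatenated matrix Y = (Y_1, …, Y_n) has rank m1, and suppose that every nonzero singular matrix X ∈ ℝ^{m2×m2} satisfies m2 · rank(Y_1X, …, Y_nX) > m1 · rank(X). Then: (a) the negated profile log-likelihood g attains its minimum on PD(m2) (equivalently, ℓ attains its maximum on PD(m1) × PD(m2)); and (b) for every sequence (Ψ^(t)) in PD(m2) with tr(Ψ^(t)) = 1 for all t that converges to a singular positive semidefinite matrix, g(Ψ^(t)) → +∞ as t → ∞. -/

import Mathlib

open Matrix Filter

/-- Horizontal concatenation. -/
def concat {m1 m2 n : ℕ} (Y : Fin n → Matrix (Fin m1) (Fin m2) ℝ) :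
    Matrix (Fin m1) (Fin n × Fin m2) ℝ :=
  Matrix.of fun i p => Y p.1 i p.2

/-- The negated profile log-likelihood
`g(Ψ) = m2·log det(Σᵢ Yᵢ Ψ Yᵢᵀ) − m1·log det Ψ`. -/
noncomputable def gfun {m1 m2 n : ℕ} (Y : Fin n → Matrix (Fin m1) (Fin m2) ℝ)
    (Ψ : Matrix (Fin m2) (Fin m2) ℝ) : ℝ :=
  (m2 : ℝ) * Real.log (∑ i, Y i * Ψ * (Y i)ᵀ).det - (m1 : ℝ) * Real.log Ψ.det

/-- Greedy choice of a basis adapted to a filtration by level. -/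
lemma aux_greedy {ι E : Type*} [Fintype ι] [AddCommGroup E] [Module ℝ E] [FiniteDimensional ℝ E]
    (w : ι → E) (f : ι → ℕ) (k : ℕ) :
    ∃ S : Finset ι, (∀ p ∈ S, f p < k) ∧ LinearIndepOn ℝ w (S : Set ι) ∧
      ∀ j ≤ k, Module.finrank ℝ (Submodule.span ℝ (w '' {p | f p < j})) ≤
        (S.filter (fun p => f p < j)).card := by
  classical
  induction k with
  | zero =>
    refine ⟨∅, by simp, by simp, ?_⟩
    intro j hj
    obtain rfl : j = 0 := by omega
    simp
  | succ k ih =>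
    obtain ⟨S, hS1, hS2, hS3⟩ := ih
    obtain ⟨b, hbt, hsb, hspan, hli⟩ := exists_linearIndepOn_extension (t := {p | f p < k + 1}) hS2
      (fun p hp => Nat.lt_succ_of_lt (hS1 p hp))
    refine ⟨b.toFinset, ?_, by simpa using hli, ?_⟩
    · intro p hp
      exact hbt (by simpa using hp)
    · intro j hj
      rcases Nat.lt_or_ge j (k + 1) with hjk | hjk
      · refine (hS3 j (by omega)).trans (Finset.card_le_card ?_)
        apply Finset.filter_subset_filter
        intro p hp
        simpa using hsb hp
      · obtain rfl : j = k + 1 := by omega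
        have h1 : Submodule.span ℝ (w '' {p | f p < k + 1}) ≤ Submodule.span ℝ (w '' b) :=
          Submodule.span_le.2 hspan
        refine (Submodule.finrank_mono h1).trans ?_
        have h2 : b.toFinset.filter (fun p => f p < k + 1) = b.toFinset := by
          apply Finset.filter_true_of_mem
          intro p hp
          exact hbt (by simpa using hp)
        rw [h2]
        have h3 := finrank_span_finset_le_card (R := ℝ) (b.toFinset.image w)
        have h4 : ((b.toFinset.image w : Finset E) : Set E) = w '' b := by simp
        rw [h4, Set.finrank] at h3
        exact h3.trans Finset.card_image_le

/-- Abel summation. -/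
lemma aux_abel {ι : Type*} [Fintype ι] (x : ℕ → ℝ) (N : ℕ) (f : ι → ℕ) (hf : ∀ i, f i ≤ N) :
    ∑ i, x (f i) = (Fintype.card ι : ℝ) * x N +
      ∑ j ∈ Finset.range N, (x j - x (j + 1)) * ((Finset.univ.filter (fun i => f i < j + 1)).card : ℝ) := by
  have h1 : ∀ i, x (f i) = x N + ∑ j ∈ Finset.range N,
      (x j - x (j + 1)) * (if f i < j + 1 then 1 else 0) := by
    intro i
    have key : ∀ M, f i ≤ M → x (f i) = x M + ∑ j ∈ Finset.range M,
      (x j - x (j + 1)) * (if f i < j + 1 then 1 else 0) := by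
      intro M hM
      induction M, hM using Nat.le_induction with
      | base =>
        rw [Finset.sum_eq_zero]
        · simp
        · intro j hj
          have := Finset.mem_range.1 hj
          rw [if_neg (by omega)]; simp
      | succ M hM ih =>
        rw [Finset.sum_range_succ, if_pos (by omega)]
        linarith
    exact key N (hf i)
  rw [Finset.sum_congr rfl (fun i _ => h1 i), Finset.sum_add_distrib, Finset.sum_comm]
  congr 1
  · simp
  · refine Finset.sum_congr rfl (fun j _ => ?_)
    rw [← Finset.mul_sum]
    simp

lemma aux_det_one_le {m : ℕ} (A : Matrix (Fin m) (Fin m) ℝ) (hA : (A - 1).PosSemidef) :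
    1 ≤ A.det := by
  have hH : A.IsHermitian := by
    have := hA.isHermitian.add (Matrix.isHermitian_one (n := Fin m) (α := ℝ))
    simpa using this
  rw [hH.det_eq_prod_eigenvalues]
  apply Finset.one_le_prod
  intro i
  have h1 := hA.dotProduct_mulVec_nonneg (⇑(hH.eigenvectorBasis i))
  rw [Matrix.sub_mulVec, hH.mulVec_eigenvectorBasis, Matrix.one_mulVec, dotProduct_sub,
    dotProduct_smul] at h1
  have h2 : star (⇑(hH.eigenvectorBasis i) : Fin m → ℝ) ⬝ᵥ ⇑(hH.eigenvectorBasis i) = 1 := by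
    rw [dotProduct_comm, ← EuclideanSpace.inner_eq_star_dotProduct,
      inner_self_eq_norm_sq_to_K, hH.eigenvectorBasis.orthonormal.1 i]
    simp
  rw [h2] at h1
  simp at h1
  simpa using h1

lemma aux_det_mono {m : ℕ} (A C : Matrix (Fin m) (Fin m) ℝ) (hC : C.det ≠ 0)
    (hA : (A - C * Cᵀ).PosSemidef) : C.det ^ 2 ≤ A.det := by
  have hu : IsUnit C.det := isUnit_iff_ne_zero.2 hC
  have hut : IsUnit Cᵀ.det := by rwa [Matrix.det_transpose]
  have h1 := hA.mul_mul_conjTranspose_same C⁻¹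
  have h2 : C⁻¹ * (A - C * Cᵀ) * C⁻¹ᴴ = C⁻¹ * A * C⁻¹ᵀ - 1 := by
    rw [Matrix.conjTranspose_eq_transpose_of_trivial, mul_sub, sub_mul, ← mul_assoc C⁻¹ C,
      Matrix.nonsing_inv_mul _ hu, one_mul, Matrix.transpose_nonsing_inv,
      Matrix.mul_nonsing_inv _ hut]
  rw [h2] at h1
  have h3 := aux_det_one_le _ h1
  rw [Matrix.det_mul, Matrix.det_mul, Matrix.det_transpose, Matrix.det_nonsing_inv,
    Ring.inverse_eq_inv'] at h3
  have h4 : 0 < C.det ^ 2 := by positivity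
  have h5 : C.det⁻¹ * A.det * C.det⁻¹ = A.det / C.det ^ 2 := by field_simp
  rw [h5, le_div_iff₀ h4] at h3
  linarith

/-- Lower bound on `det (W D Wᵀ)` by one squared minor. -/
lemma aux_minor {m : ℕ} {ι : Type*} [Fintype ι] [DecidableEq ι] (W : Matrix (Fin m) ι ℝ)
    (d : ι → ℝ) (hd : ∀ p, 0 < d p) (s : Fin m → ι) (hs : Function.Injective s)
    (hdet : (W.submatrix id s).det ≠ 0) :
    (W.submatrix id s).det ^ 2 * ∏ a, d (s a) ≤ (W * Matrix.diagonal d * Wᵀ).det := by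
  set C := W.submatrix id s * Matrix.diagonal (fun a => Real.sqrt (d (s a))) with hCdef
  have hCd : C.det = (W.submatrix id s).det * ∏ a, Real.sqrt (d (s a)) := by
    rw [hCdef, Matrix.det_mul, Matrix.det_diagonal]
  have hCd2 : C.det ^ 2 = (W.submatrix id s).det ^ 2 * ∏ a, d (s a) := by
    rw [hCd, mul_pow, ← Finset.prod_pow]
    congr 1
    exact Finset.prod_congr rfl (fun a _ => Real.sq_sqrt (hd _).le)
  rw [← hCd2]
  apply aux_det_mono
  · rw [hCd]
    refine mul_ne_zero hdet (Finset.prod_ne_zero_iff.2 fun a _ => ?_)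
    exact (Real.sqrt_pos.2 (hd _)).ne'
  · have hform : W * Matrix.diagonal d * Wᵀ - C * Cᵀ =
        W * Matrix.diagonal (fun p => if p ∈ Set.range s then 0 else d p) * Wᵀ := by
      classical
      ext i j
      have e1 : (C * Cᵀ) i j = ∑ a, W i (s a) * d (s a) * W j (s a) := by
        rw [Matrix.mul_apply]
        refine Finset.sum_congr rfl (fun a _ => ?_)
        simp only [hCdef, Matrix.mul_diagonal, Matrix.transpose_apply, Matrix.submatrix_apply, id]
        have := Real.mul_self_sqrt (hd (s a)).le
        linear_combination W i (s a) * W j (s a) * this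
      have e2 : ∑ a, W i (s a) * d (s a) * W j (s a) =
          ∑ p, if p ∈ Set.range s then W i p * d p * W j p else 0 := by
        rw [← Finset.sum_filter, ← Finset.sum_image (s := Finset.univ) (g := s)
          (f := fun p => W i p * d p * W j p) (fun a _ b _ hab => hs hab)]
        refine Finset.sum_congr ?_ (fun _ _ => rfl)
        ext p
        simp
      rw [Matrix.sub_apply, e1, e2, Matrix.mul_apply, Matrix.mul_apply, ← Finset.sum_sub_distrib]
      refine Finset.sum_congr rfl (fun p _ => ?_)
      simp only [Matrix.mul_diagonal, Matrix.transpose_apply]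
      split_ifs <;> simp
    rw [hform, ← Matrix.conjTranspose_eq_transpose_of_trivial]
    apply Matrix.PosSemidef.mul_mul_conjTranspose_same
    apply Matrix.PosSemidef.diagonal
    intro p
    simp only [Pi.zero_apply]
    split_ifs
    · exact le_rfl
    · exact (hd p).le

lemma aux_spectral {m : ℕ} (Ψ : Matrix (Fin m) (Fin m) ℝ) (hΨ : Ψ.PosDef) :
    ∃ (V : Matrix (Fin m) (Fin m) ℝ) (l : Fin m → ℝ), Vᵀ * V = 1 ∧ Antitone l ∧ (∀ i, 0 < l i) ∧
      Ψ = V * Matrix.diagonal l * Vᵀ := by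
  set H := hΨ.isHermitian
  set U : Matrix (Fin m) (Fin m) ℝ := (H.eigenvectorUnitary : Matrix (Fin m) (Fin m) ℝ) with hU
  set σ := Tuple.sort (fun i => - H.eigenvalues i) with hσ
  have hmono := Tuple.monotone_sort (fun i => - H.eigenvalues i)
  have hsp : Ψ = U * Matrix.diagonal H.eigenvalues * Uᵀ := by
    have := H.spectral_theorem
    rw [Unitary.conjStarAlgAut_apply] at this
    exact this
  have hUU : Uᵀ * U = 1 := by
    have := Unitary.coe_star_mul_self H.eigenvectorUnitary
    exact this
  refine ⟨U.submatrix id σ, H.eigenvalues ∘ σ, ?_, ?_, ?_, ?_⟩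
  · ext i j
    have := congrFun (congrFun hUU (σ i)) (σ j)
    simp only [Matrix.mul_apply, Matrix.transpose_apply, Matrix.submatrix_apply, id,
      Matrix.one_apply, σ.injective.eq_iff] at this ⊢
    exact this
  · intro i j hij
    have := hmono hij
    simpa using this
  · intro i
    exact hΨ.eigenvalues_pos _
  · conv_lhs => rw [hsp]
    ext i j
    simp only [Matrix.mul_apply (M := _ * Matrix.diagonal _), Matrix.mul_diagonal,
      Matrix.transpose_apply, Matrix.submatrix_apply, id, Function.comp]
    exact (Equiv.sum_comp σ (fun k => U i k * H.eigenvalues k * U j k)).symm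

lemma aux_compact (m : ℕ) : IsCompact {V : Matrix (Fin m) (Fin m) ℝ | Vᵀ * V = 1} := by
  have hK : IsCompact (Set.pi Set.univ (fun _ : Fin m => Set.pi Set.univ
      (fun _ : Fin m => Set.Icc (-1 : ℝ) 1))) :=
    isCompact_univ_pi fun _ => isCompact_univ_pi fun _ => isCompact_Icc
  refine IsCompact.of_isClosed_subset hK ?_ ?_
  · exact isClosed_eq (by fun_prop) continuous_const
  · intro V hV i _ j _
    have hV' : V ∈ Matrix.unitaryGroup (Fin m) ℝ := Matrix.mem_unitaryGroup_iff'.2 hV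
    have := entry_norm_bound_of_unitary hV' i j
    exact abs_le.1 this

/-- The admissible column selections. -/
def aux_good (m1 m2 n : ℕ) (s : Fin m1 → Fin n × Fin m2) : Prop :=
  Function.Injective s ∧ ∀ k, 0 < k → k < m2 →
    m1 * k < m2 * (Finset.univ.filter (fun a => ((s a).2 : ℕ) < k)).card

lemma aux_select {m1 m2 n : ℕ} (Y : Fin n → Matrix (Fin m1) (Fin m2) ℝ)
    (hY : (concat Y).rank = m1)
    (h : ∀ X : Matrix (Fin m2) (Fin m2) ℝ, X ≠ 0 → X.det = 0 →
      m1 * X.rank < m2 * (concat fun i => Y i * X).rank)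
    (V : Matrix (Fin m2) (Fin m2) ℝ) (hV : Vᵀ * V = 1) :
    ∃ s, aux_good m1 m2 n s ∧ ((concat fun i => Y i * V).submatrix id s).det ≠ 0 := by
  classical
  have hV2 : V * Vᵀ = 1 := mul_eq_one_comm.1 hV
  have hVdet : IsUnit V.det := by
    have := congrArg Matrix.det hV
    rw [Matrix.det_mul, Matrix.det_one] at this
    exact IsUnit.of_mul_eq_one _ ((mul_comm _ _).trans this)
  set w : Fin n × Fin m2 → (Fin m1 → ℝ) := (concat fun i => Y i * V).col with hw
  obtain ⟨S, hS1, hS2, hS3⟩ := aux_greedy w (fun p => (p.2 : ℕ)) m2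
  have hfull : m1 ≤ S.card := by
    have h1 := hS3 m2 le_rfl
    have h2 : m1 ≤ Module.finrank ℝ (Submodule.span ℝ (w '' {p | (p.2 : ℕ) < m2})) := by
      conv_lhs => rw [← hY, Matrix.rank_eq_finrank_span_cols]
      apply Submodule.finrank_mono
      rw [Submodule.span_le]
      rintro _ ⟨p, rfl⟩
      have : (concat Y).col p = ∑ k, V p.2 k • w (p.1, k) := by
        ext r
        have e : Y p.1 = Y p.1 * V * Vᵀ := by rw [Matrix.mul_assoc, hV2, Matrix.mul_one]
        simp only [Matrix.col_apply, concat, Matrix.of_apply, Finset.sum_apply, Pi.smul_apply, hw,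
          smul_eq_mul]
        conv_lhs => rw [e, Matrix.mul_apply]
        exact Finset.sum_congr rfl fun k _ => by rw [Matrix.transpose_apply, mul_comm]
      rw [this]
      refine Submodule.sum_mem _ fun k _ => Submodule.smul_mem _ _ (Submodule.subset_span ?_)
      exact ⟨(p.1, k), k.2, rfl⟩
    exact h2.trans (h1.trans (Finset.card_filter_le _ _))
  have hle : S.card ≤ m1 := by
    have := LinearIndependent.fintype_card_le_finrank hS2
    simpa using this
  have hcard : S.card = m1 := le_antisymm hle hfull
  set e := (S.equivFinOfCardEq hcard).symm with he
  refine ⟨fun a => (e a).1, ⟨?_, ?_⟩, ?_⟩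
  · intro a b hab
    exact e.injective (Subtype.ext hab)
  · intro k hk0 hk
    set X := V * Matrix.diagonal (fun j : Fin m2 => if (j : ℕ) < k then (1 : ℝ) else 0) with hX
    have hXrank : X.rank = k := by
      rw [hX, Matrix.rank_mul_eq_right_of_isUnit_det _ _ hVdet, Matrix.rank_diagonal,
        Fintype.card_subtype]
      have : (Finset.univ.filter fun j : Fin m2 => (if (j : ℕ) < k then (1 : ℝ) else 0) ≠ 0)
          = Finset.univ.filter fun j : Fin m2 => (j : ℕ) < k := by
        ext j; simp
      rw [this, Fin.card_filter_val_lt]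
      omega
    have hX0 : X ≠ 0 := by
      intro h0
      rw [h0, Matrix.rank_zero] at hXrank
      omega
    have hXdet : X.det = 0 := by
      rw [hX, Matrix.det_mul, Matrix.det_diagonal]
      rw [Finset.prod_eq_zero (Finset.mem_univ (⟨k, hk⟩ : Fin m2)) (by simp), mul_zero]
    have h1 := h X hX0 hXdet
    rw [hXrank] at h1
    refine h1.trans_le (Nat.mul_le_mul_left _ ?_)
    have h2 : (concat fun i => Y i * X).rank ≤
        Module.finrank ℝ (Submodule.span ℝ (w '' {p | (p.2 : ℕ) < k})) := by
      rw [Matrix.rank_eq_finrank_span_cols]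
      apply Submodule.finrank_mono
      rw [Submodule.span_le]
      rintro _ ⟨p, rfl⟩
      have e1 : (concat fun i => Y i * X).col p = (if (p.2 : ℕ) < k then (1 : ℝ) else 0) • w p := by
        ext r
        simp only [Matrix.col_apply, concat, Matrix.of_apply, Pi.smul_apply, hw,
          smul_eq_mul, hX, ← Matrix.mul_assoc, Matrix.mul_diagonal]
        exact mul_comm _ _
      rw [e1]
      split_ifs with hp
      · rw [one_smul]
        exact Submodule.subset_span ⟨p, hp, rfl⟩
      · rw [zero_smul]
        exact Submodule.zero_mem _
    refine h2.trans ((hS3 k hk.le).trans ?_)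
    have h3 : S.filter (fun p => (p.2 : ℕ) < k) ⊆
        (Finset.univ.filter (fun a => ((e a).1.2 : ℕ) < k)).image (fun a => (e a).1) := by
      intro p hp
      rw [Finset.mem_filter] at hp
      refine Finset.mem_image.2 ⟨e.symm ⟨p, hp.1⟩, ?_, ?_⟩
      · simpa using hp.2
      · simp
    exact (Finset.card_le_card h3).trans Finset.card_image_le
  · have hli : LinearIndependent ℝ (fun a => w (e a).1) :=
      LinearIndependent.comp (R := ℝ) (v := fun x : S => w x.1) hS2 e e.injective
    have : IsUnit ((concat fun i => Y i * V).submatrix id (fun a => (e a).1)) :=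
      Matrix.linearIndependent_cols_iff_isUnit.1 hli
    exact ((Matrix.isUnit_iff_isUnit_det _).1 this).ne_zero

lemma aux_uniform {m1 m2 n : ℕ} (Y : Fin n → Matrix (Fin m1) (Fin m2) ℝ)
    (hY : (concat Y).rank = m1)
    (h : ∀ X : Matrix (Fin m2) (Fin m2) ℝ, X ≠ 0 → X.det = 0 →
      m1 * X.rank < m2 * (concat fun i => Y i * X).rank) :
    ∃ c : ℝ, 0 < c ∧ ∀ V : Matrix (Fin m2) (Fin m2) ℝ, Vᵀ * V = 1 →
      ∃ s, aux_good m1 m2 n s ∧ c ≤ ((concat fun i => Y i * V).submatrix id s).det ^ 2 := by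
  classical
  set F : Matrix (Fin m2) (Fin m2) ℝ → ℝ := fun V =>
    ∑ s ∈ Finset.univ.filter (fun s => aux_good m1 m2 n s),
      ((concat fun i => Y i * V).submatrix id s).det ^ 2 with hF
  have hcont : Continuous F := by
    refine continuous_finsetSum _ fun s _ => Continuous.pow (Continuous.matrix_det ?_) 2
    refine continuous_matrix fun i j => ?_
    change Continuous fun V : Matrix (Fin m2) (Fin m2) ℝ => (Y (s j).1 * V) i (s j).2
    exact Continuous.matrix_elem (by fun_prop) _ _
  obtain ⟨V0, hV0, hmin⟩ := (aux_compact m2).exists_isMinOn ⟨1, by simp⟩ hcont.continuousOn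
  have hpos : 0 < F V0 := by
    obtain ⟨s, hs, hd⟩ := aux_select Y hY h V0 hV0
    have h1 : ((concat fun i => Y i * V0).submatrix id s).det ^ 2 ≤ F V0 :=
      Finset.single_le_sum (f := fun s => ((concat fun i => Y i * V0).submatrix id s).det ^ 2)
        (fun s _ => sq_nonneg _) (by simpa using hs)
    have : 0 < ((concat fun i => Y i * V0).submatrix id s).det ^ 2 := by positivity
    linarith
  set N : ℝ := ((Finset.univ.filter (fun s => aux_good m1 m2 n s)).card : ℝ) with hN
  refine ⟨F V0 / (N + 1), by positivity, fun V hV => ?_⟩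
  by_contra hcon
  push Not at hcon
  have h1 : F V0 ≤ F V := hmin hV
  have h2 : F V ≤ N * (F V0 / (N + 1)) := by
    rw [hN, ← nsmul_eq_mul]
    apply Finset.sum_le_card_nsmul
    intro s hs
    exact (hcon s (by simpa using hs)).le
  have h3 : N * (F V0 / (N + 1)) < F V0 := by
    rw [← mul_div_assoc, div_lt_iff₀ (by positivity)]
    nlinarith
  linarith

lemma aux_key {m1 m2 n : ℕ} (hm2 : 0 < m2) (Y : Fin n → Matrix (Fin m1) (Fin m2) ℝ)
    (hY : (concat Y).rank = m1)
    (h : ∀ X : Matrix (Fin m2) (Fin m2) ℝ, X ≠ 0 → X.det = 0 →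
      m1 * X.rank < m2 * (concat fun i => Y i * X).rank) :
    ∃ C : ℝ, ∀ Ψ : Matrix (Fin m2) (Fin m2) ℝ, Ψ.PosDef →
      0 < (∑ i, Y i * Ψ * (Y i)ᵀ).det ∧
      (Ψ.trace = 1 → C - (1 / (m2 : ℝ)) * Real.log Ψ.det ≤ gfun Y Ψ) := by
  obtain ⟨c, hc, hunif⟩ := aux_uniform Y hY h
  obtain ⟨N, rfl⟩ : ∃ N, m2 = N + 1 := ⟨m2 - 1, by omega⟩
  refine ⟨(N + 1 : ℕ) * Real.log c - Real.log (N + 1 : ℕ), fun Ψ hΨ => ?_⟩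
  obtain ⟨V, l, hV, hl, hlpos, hΨV⟩ := aux_spectral Ψ hΨ
  obtain ⟨s, ⟨hinj, hgood⟩, hcs⟩ := hunif V hV
  obtain ⟨W, hW⟩ : ∃ W : Matrix (Fin m1) (Fin n × Fin (N + 1)) ℝ, W = concat fun i => Y i * V :=
    ⟨_, rfl⟩
  rw [← hW] at hcs
  have hM : (∑ i, Y i * Ψ * (Y i)ᵀ) = W *
      Matrix.diagonal (fun p : Fin n × Fin (N + 1) => l p.2) * Wᵀ := by
    ext r q
    rw [Matrix.sum_apply, Matrix.mul_apply, Fintype.sum_prod_type]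
    refine Finset.sum_congr rfl fun i _ => ?_
    have e : Y i * Ψ * (Y i)ᵀ = (Y i * V) * Matrix.diagonal l * (Y i * V)ᵀ := by
      rw [hΨV, Matrix.transpose_mul]; simp only [Matrix.mul_assoc]
    rw [e, Matrix.mul_apply]
    refine Finset.sum_congr rfl fun k _ => ?_
    simp only [Matrix.mul_diagonal, Matrix.transpose_apply, hW, concat, Matrix.of_apply]
  have hdne : (W.submatrix id s).det ≠ 0 := by
    intro h0
    rw [h0] at hcs
    norm_num at hcs
    linarith
  have hprod : 0 < ∏ a, l (s a).2 := Finset.prod_pos fun a _ => hlpos _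
  have hdet : c * ∏ a, l (s a).2 ≤ (∑ i, Y i * Ψ * (Y i)ᵀ).det := by
    rw [hM]
    refine le_trans ?_ (aux_minor W (fun p : Fin n × Fin (N + 1) => l p.2) (fun p => hlpos _)
      s hinj hdne)
    exact mul_le_mul_of_nonneg_right hcs hprod.le
  have hMpos : 0 < (∑ i, Y i * Ψ * (Y i)ᵀ).det := lt_of_lt_of_le (mul_pos hc hprod) hdet
  refine ⟨hMpos, fun htr => ?_⟩
  have hVdet : V.det * V.det = 1 := by
    have := congrArg Matrix.det hV
    rwa [Matrix.det_mul, Matrix.det_one, Matrix.det_transpose] at this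
  have hΨdet : Ψ.det = ∏ k, l k := by
    rw [hΨV, Matrix.det_mul, Matrix.det_mul, Matrix.det_transpose, Matrix.det_diagonal]
    linear_combination (∏ k, l k) * hVdet
  have hΨtr : ∑ k, l k = 1 := by
    rw [← htr, hΨV, Matrix.trace_mul_comm, ← mul_assoc, hV, one_mul, Matrix.trace_diagonal]
  set x : ℕ → ℝ := fun k => Real.log (l ⟨min k N, by omega⟩) with hx
  have hxv : ∀ k : Fin (N + 1), Real.log (l k) = x k := by
    intro k
    simp only [hx]
    congr 2
    ext
    simp
    omega
  have hxanti : ∀ j, x (j + 1) ≤ x j := by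
    intro j
    apply Real.log_le_log (hlpos _)
    apply hl
    rw [Fin.mk_le_mk]
    omega
  have hlogM : Real.log c + ∑ a, x (s a).2 ≤ Real.log (∑ i, Y i * Ψ * (Y i)ᵀ).det := by
    refine le_trans (le_of_eq ?_) (Real.log_le_log (mul_pos hc hprod) hdet)
    rw [Real.log_mul hc.ne' hprod.ne', Real.log_prod (fun a _ => (hlpos _).ne')]
    simp only [hxv]
  have hlogΨ : Real.log Ψ.det = ∑ k : Fin (N + 1), x k := by
    rw [hΨdet, Real.log_prod (fun a _ => (hlpos _).ne')]
    simp only [hxv]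
  have hA1 := aux_abel x N (fun a => ((s a).2 : ℕ)) (fun a => by omega)
  have hA2 := aux_abel x N (fun k : Fin (N + 1) => (k : ℕ)) (fun a => by omega)
  have hsum : x 0 - x N ≤ ((N + 1 : ℕ) : ℝ) * ∑ a, x (s a).2 -
      (m1 : ℝ) * ∑ k : Fin (N + 1), x k := by
    rw [hA1, hA2, Fintype.card_fin, Fintype.card_fin, ← Finset.sum_range_sub' x N]
    have e : ∀ (P Q : ℝ), ((N + 1 : ℕ) : ℝ) * ((m1 : ℝ) * x N + P) -
      (m1 : ℝ) * (((N + 1 : ℕ) : ℝ) * x N + Q) = ((N + 1 : ℕ) : ℝ) * P - (m1 : ℝ) * Q := by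
      intro P Q; ring
    rw [e, Finset.mul_sum, Finset.mul_sum, ← Finset.sum_sub_distrib]
    refine Finset.sum_le_sum fun j hj => ?_
    have hj' := Finset.mem_range.1 hj
    have h1 := hgood (j + 1) (by omega) (by omega)
    have h2 : (Finset.univ.filter fun k : Fin (N + 1) => (k : ℕ) < j + 1).card = j + 1 := by
      rw [Fin.card_filter_val_lt]; omega
    rw [h2]
    have h3 : (m1 : ℝ) * ((j + 1 : ℕ) : ℝ) + 1 ≤ ((N + 1 : ℕ) : ℝ) *
        ((Finset.univ.filter (fun a => ((s a).2 : ℕ) < j + 1)).card : ℝ) := by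
      exact_mod_cast h1
    have h4 := hxanti j
    nlinarith
  have hxle : ∀ k : ℕ, k ≤ N → x N ≤ x k := fun k hk => antitone_nat_of_succ_le hxanti hk
  have hNpos : (0 : ℝ) < ((N + 1 : ℕ) : ℝ) := by positivity
  have hlast : x N ≤ (1 / ((N + 1 : ℕ) : ℝ)) * Real.log Ψ.det := by
    rw [hlogΨ, one_div, inv_mul_eq_div, le_div_iff₀ hNpos]
    have := Finset.card_nsmul_le_sum (Finset.univ : Finset (Fin (N + 1))) (fun k => x k) (x N)
      (fun k _ => hxle k (by omega))
    rw [nsmul_eq_mul, Finset.card_univ, Fintype.card_fin] at this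
    linarith
  have hfirst : - Real.log (N + 1 : ℕ) ≤ x 0 := by
    rw [← Real.log_inv]
    apply Real.log_le_log (by positivity)
    have := Finset.sum_le_card_nsmul (Finset.univ : Finset (Fin (N + 1))) l (l 0)
      (fun k _ => hl (Fin.zero_le k))
    rw [nsmul_eq_mul, Finset.card_univ, Fintype.card_fin, hΨtr] at this
    rw [inv_le_iff_one_le_mul₀ hNpos, mul_comm]
    simpa using this
  have hmul := mul_le_mul_of_nonneg_left hlogM hNpos.le
  rw [mul_add] at hmul
  rw [← hlogΨ] at hsum
  unfold gfun
  linarith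

/-- Suppose the concatenated data matrix has full row rank `m1` and every nonzero singular
`X ∈ ℝ^{m2×m2}` satisfies `m2 · rank(Y_1X, …, Y_nX) > m1 · rank(X)`.  Then (a) `g` attains
its minimum on `PD(m2)`, and (b) for every sequence of positive definite matrices with
unit trace converging to a singular positive semidefinite matrix, `g` tends to `+∞`. -/
theorem stmt7 {m1 m2 n : ℕ} (Y : Fin n → Matrix (Fin m1) (Fin m2) ℝ)
    (hY : (concat Y).rank = m1)
    (h : ∀ X : Matrix (Fin m2) (Fin m2) ℝ, X ≠ 0 → X.det = 0 →
      m1 * X.rank < m2 * (concat fun i => Y i * X).rank) :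
    (∃ Ψ0 : Matrix (Fin m2) (Fin m2) ℝ, Ψ0.PosDef ∧
      ∀ Ψ : Matrix (Fin m2) (Fin m2) ℝ, Ψ.PosDef → gfun Y Ψ0 ≤ gfun Y Ψ) ∧
    (∀ (Ψseq : ℕ → Matrix (Fin m2) (Fin m2) ℝ) (Ψlim : Matrix (Fin m2) (Fin m2) ℝ),
      (∀ t, (Ψseq t).PosDef) → (∀ t, (Ψseq t).trace = 1) →
      Tendsto Ψseq atTop (nhds Ψlim) → Ψlim.PosSemidef → Ψlim.det = 0 →
      Tendsto (fun t => gfun Y (Ψseq t)) atTop atTop) := by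
  rcases Nat.eq_zero_or_pos m2 with rfl | hm2
  · have hsub : ∀ A B : Matrix (Fin 0) (Fin 0) ℝ, A = B := fun A B => Subsingleton.elim A B
    refine ⟨⟨1, Matrix.PosDef.one, fun Ψ _ => by rw [hsub Ψ 1]⟩, ?_⟩
    intro Ψseq Ψlim _ htr
    have := htr 0
    simp [Matrix.trace] at this
  obtain ⟨C, hC⟩ := aux_key hm2 Y hY h
  have hm2R : (0 : ℝ) < m2 := by exact_mod_cast hm2
  have : Nonempty (Fin m2) := ⟨⟨0, hm2⟩⟩
  refine ⟨?_, ?_⟩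
  · skip
    set I0 : Matrix (Fin m2) (Fin m2) ℝ := (m2 : ℝ)⁻¹ • 1 with hI0
    have hI0pd : I0.PosDef := Matrix.PosDef.one.smul (inv_pos.2 hm2R)
    have hI0tr : I0.trace = 1 := by
      rw [hI0, Matrix.trace_smul, Matrix.trace_one, Fintype.card_fin, smul_eq_mul,
        inv_mul_cancel₀ hm2R.ne']
    have hI0det := hI0pd.det_pos
    set ε : ℝ := min I0.det (Real.exp ((m2 : ℝ) * (C - gfun Y I0))) with hε
    have hεpos : 0 < ε := lt_min hI0det (Real.exp_pos _)
    set K : Set (Matrix (Fin m2) (Fin m2) ℝ) :=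
      (fun q : Matrix (Fin m2) (Fin m2) ℝ × (Fin m2 → ℝ) => q.1 * Matrix.diagonal q.2 * q.1ᵀ) ''
        ({V : Matrix (Fin m2) (Fin m2) ℝ | Vᵀ * V = 1} ×ˢ stdSimplex ℝ (Fin m2)) ∩
        {Ψ | ε ≤ Ψ.det} with hK
    have hKcomp : IsCompact K := by
      refine IsCompact.inter_right ?_ ?_
      · refine IsCompact.image ((aux_compact m2).prod (isCompact_stdSimplex ℝ (Fin m2))) ?_
        fun_prop
      · exact isClosed_le continuous_const (by fun_prop)
    have hKpd : ∀ Ψ ∈ K, Ψ.PosDef := by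
      rintro Ψ ⟨⟨⟨V, l⟩, ⟨_, hl⟩, rfl⟩, hdet⟩
      have hps : (V * Matrix.diagonal l * Vᵀ).PosSemidef := by
        rw [← Matrix.conjTranspose_eq_transpose_of_trivial]
        exact (Matrix.PosSemidef.diagonal (fun i => hl.1 i)).mul_mul_conjTranspose_same V
      refine hps.posDef_iff_det_ne_zero.2 ?_
      have : ε ≤ (V * Matrix.diagonal l * Vᵀ).det := hdet
      exact (lt_of_lt_of_le hεpos this).ne'
    have hKmem : ∀ Ψ : Matrix (Fin m2) (Fin m2) ℝ, Ψ.PosDef → Ψ.trace = 1 → ε ≤ Ψ.det → Ψ ∈ K := by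
      intro Ψ hΨ htr hdet
      refine ⟨?_, hdet⟩
      obtain ⟨V, l, hV, _, hlpos, hΨV⟩ := aux_spectral Ψ hΨ
      refine ⟨(V, l), ⟨hV, fun i => (hlpos i).le, ?_⟩, hΨV.symm⟩
      rw [← htr, hΨV, Matrix.trace_mul_comm, ← mul_assoc, hV, one_mul, Matrix.trace_diagonal]
    have hgcont : ContinuousOn (gfun Y) K := by
      unfold gfun
      refine ContinuousOn.sub (ContinuousOn.mul continuousOn_const ?_)
        (ContinuousOn.mul continuousOn_const ?_)
      · refine ContinuousOn.log (Continuous.continuousOn (by fun_prop)) ?_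
        intro Ψ hΨ
        exact (hC Ψ (hKpd Ψ hΨ)).1.ne'
      · refine ContinuousOn.log (Continuous.continuousOn (by fun_prop)) ?_
        intro Ψ hΨ
        exact (hKpd Ψ hΨ).det_pos.ne'
    have hI0K : I0 ∈ K := hKmem I0 hI0pd hI0tr (min_le_left _ _)
    obtain ⟨Ψ0, hΨ0, hmin⟩ := hKcomp.exists_isMinOn ⟨I0, hI0K⟩ hgcont
    have htr1 : ∀ Ψ : Matrix (Fin m2) (Fin m2) ℝ, Ψ.PosDef → Ψ.trace = 1 →
        gfun Y Ψ0 ≤ gfun Y Ψ := by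
      intro Ψ hΨ htr
      by_cases hdet : ε ≤ Ψ.det
      · exact hmin (hKmem Ψ hΨ htr hdet)
      · push Not at hdet
        have h1 : gfun Y Ψ0 ≤ gfun Y I0 := hmin hI0K
        have h2 := (hC Ψ hΨ).2 htr
        have h3 : Real.log Ψ.det ≤ (m2 : ℝ) * (C - gfun Y I0) := by
          rw [Real.log_le_iff_le_exp hΨ.det_pos]
          exact hdet.le.trans (min_le_right _ _)
        have h4 : (1 / (m2 : ℝ)) * Real.log Ψ.det ≤ C - gfun Y I0 := by
          rw [one_div, inv_mul_eq_div, div_le_iff₀ hm2R]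
          linarith
        linarith
    refine ⟨Ψ0, hKpd Ψ0 hΨ0, fun Ψ hΨ => ?_⟩
    have htrpos : 0 < Ψ.trace := hΨ.trace_pos
    have hcpos : 0 < (Ψ.trace)⁻¹ := inv_pos.2 htrpos
    have hscale : gfun Y ((Ψ.trace)⁻¹ • Ψ) = gfun Y Ψ := by
      have hs : (∑ i, Y i * ((Ψ.trace)⁻¹ • Ψ) * (Y i)ᵀ) =
          (Ψ.trace)⁻¹ • ∑ i, Y i * Ψ * (Y i)ᵀ := by
        rw [Finset.smul_sum]
        refine Finset.sum_congr rfl fun i _ => ?_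
        rw [Matrix.mul_smul, Matrix.smul_mul]
      unfold gfun
      rw [hs, Matrix.det_smul, Matrix.det_smul, Fintype.card_fin, Fintype.card_fin,
        Real.log_mul (pow_pos hcpos _).ne' (hC Ψ hΨ).1.ne',
        Real.log_mul (pow_pos hcpos _).ne' hΨ.det_pos.ne', Real.log_pow, Real.log_pow]
      ring
    rw [← hscale]
    refine htr1 _ (hΨ.smul hcpos) ?_
    rw [Matrix.trace_smul, smul_eq_mul, inv_mul_cancel₀ htrpos.ne']
  · skip
    intro Ψseq Ψlim hpd htr hlim _ hdet0
    have h1 : Tendsto (fun t => (Ψseq t).det) atTop (nhdsWithin 0 (Set.Ioi 0)) := by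
      rw [tendsto_nhdsWithin_iff]
      refine ⟨?_, Eventually.of_forall fun t => (hpd t).det_pos⟩
      rw [← hdet0]
      have hc : Continuous fun A : Matrix (Fin m2) (Fin m2) ℝ => A.det := by fun_prop
      exact (hc.tendsto Ψlim).comp hlim
    have h2 := Real.tendsto_log_nhdsGT_zero.comp h1
    have h3 : Tendsto (fun t => C - (1 / (m2 : ℝ)) * Real.log (Ψseq t).det) atTop atTop := by
      have h4 := (h2.const_mul_atBot (one_div_pos.2 hm2R))
      have h5 := tendsto_atTop_add_const_left atTop C (tendsto_neg_atBot_atTop.comp h4)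
      refine h5.congr fun t => ?_
      simp [sub_eq_add_neg]
    exact tendsto_atTop_mono (fun t => (hC _ (hpd t)).2 (htr t)) h3
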